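/- Let (L,T,R) be a quantum triad. Then the triad is strong if and only if the greatest element of the complete lattice Q₁ equals ⟨⊤_R, ⊤_L⟩, i.e. the pair of maps (l ↦ (l·⊤_R)·⊤_L, r ↦ ⊤_R·(⊤_L·r)). -/

import Mathlib

/-- A quantum triad `(L,T,R)`: a quantale `T`, a left `T`-module `L`,
a right `T`-module `R`, and a pairing `L × R → T`, all bimorphisms
(preserving arbitrary suprema in each variable) and satisfying the five
associative laws (TTT, TTL, RTT, LRT, TLR). -/
structure Triad (L T R : Type*)
    [CompleteLattice L] [CompleteLattice T] [CompleteLattice R] where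
  tmul : T → T → T
  smulL : T → L → L
  smulR : R → T → R
  pair : L → R → T
  tmul_sSup_left : ∀ (s : Set T) (b : T), tmul (sSup s) b = ⨆ a ∈ s, tmul a b
  tmul_sSup_right : ∀ (a : T) (s : Set T), tmul a (sSup s) = ⨆ b ∈ s, tmul a b
  smulL_sSup_left : ∀ (s : Set T) (l : L), smulL (sSup s) l = ⨆ t ∈ s, smulL t l
  smulL_sSup_right : ∀ (t : T) (s : Set L), smulL t (sSup s) = ⨆ l ∈ s, smulL t l
  smulR_sSup_left : ∀ (s : Set R) (t : T), smulR (sSup s) t = ⨆ r ∈ s, smulR r t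
  smulR_sSup_right : ∀ (r : R) (s : Set T), smulR r (sSup s) = ⨆ t ∈ s, smulR r t
  pair_sSup_left : ∀ (s : Set L) (r : R), pair (sSup s) r = ⨆ l ∈ s, pair l r
  pair_sSup_right : ∀ (l : L) (s : Set R), pair l (sSup s) = ⨆ r ∈ s, pair l r
  tmul_assoc : ∀ a b c : T, tmul (tmul a b) c = tmul a (tmul b c)
  smulL_assoc : ∀ (t t' : T) (l : L), smulL (tmul t t') l = smulL t (smulL t' l)
  smulR_assoc : ∀ (r : R) (t t' : T), smulR (smulR r t) t' = smulR r (tmul t t')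
  pair_smulR : ∀ (l : L) (r : R) (t : T), tmul (pair l r) t = pair l (smulR r t)
  smulL_pair : ∀ (t : T) (l : L) (r : R), pair (smulL t l) r = tmul t (pair l r)

variable {L T R : Type*} [CompleteLattice L] [CompleteLattice T] [CompleteLattice R]

/-- `Q₁`: pairs `(α,β)` of suprema-preserving `T`-equivariant endomaps of `L`
resp. `R` satisfying `α(l)·r = l·β(r)`. -/
def Triad.Q1 (τ : Triad L T R) : Set ((L → L) × (R → R)) :=
  fun p =>
    (∀ s : Set L, p.1 (sSup s) = ⨆ l ∈ s, p.1 l) ∧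
    (∀ (t : T) (l : L), p.1 (τ.smulL t l) = τ.smulL t (p.1 l)) ∧
    (∀ s : Set R, p.2 (sSup s) = ⨆ r ∈ s, p.2 r) ∧
    (∀ (r : R) (t : T), p.2 (τ.smulR r t) = τ.smulR (p.2 r) t) ∧
    (∀ (l : L) (r : R), τ.pair (p.1 l) r = τ.pair l (p.2 r))

/-- Multiplication on `Q₁`: `(α,β)·(α',β') = (α'∘α, β∘β')`. -/
def q1mul (p q : (L → L) × (R → R)) : (L → L) × (R → R) :=
  (q.1 ∘ p.1, p.2 ∘ q.2)

/-- `⟨r,l⟩ = (l' ↦ (l'·r)·l, r' ↦ r·(l·r'))`. -/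
def Triad.rl (τ : Triad L T R) (r : R) (l : L) : (L → L) × (R → R) :=
  (fun l' => τ.smulL (τ.pair l' r) l, fun r' => τ.smulR r (τ.pair l r'))

/-- The triad is strong if `l ≤ (l·⊤_R)·⊤_L` and `r ≤ ⊤_R·(⊤_L·r)`. -/
def Triad.Strong (τ : Triad L T R) : Prop :=
  (∀ l : L, l ≤ τ.smulL (τ.pair l ⊤) ⊤) ∧ (∀ r : R, r ≤ τ.smulR ⊤ (τ.pair ⊤ r))

/-- `e` is a unit for the triad: a unit of `T` acting unitally on `L` and `R`. -/
def Triad.IsTriadUnit (τ : Triad L T R) (e : T) : Prop :=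
  (∀ t : T, τ.tmul e t = t) ∧ (∀ t : T, τ.tmul t e = t) ∧
  (∀ l : L, τ.smulL e l = l) ∧ (∀ r : R, τ.smulR r e = r)

/-- The triad is strict (with unit `e`): strong, unital, and `⊤_L·⊤_R = e`. -/
def Triad.Strict (τ : Triad L T R) (e : T) : Prop :=
  τ.Strong ∧ τ.IsTriadUnit e ∧ τ.pair ⊤ ⊤ = e

lemma monotone_of_map_sSup {A B : Type*} [CompleteLattice A] [CompleteLattice B] {f : A → B}
    (hf : ∀ s : Set A, f (sSup s) = ⨆ a ∈ s, f a) : Monotone f := by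
  intro a b hab
  have h := hf {a, b}
  rw [sSup_pair, sup_eq_right.2 hab, iSup_pair] at h
  exact h ▸ le_sup_left

lemma map_map_sSup {A B C : Type*} [CompleteLattice A] [CompleteLattice B] [CompleteLattice C]
    {f : A → B} {g : B → C} (hf : ∀ s : Set A, f (sSup s) = ⨆ a ∈ s, f a)
    (hg : ∀ s : Set B, g (sSup s) = ⨆ b ∈ s, g b) (s : Set A) :
    g (f (sSup s)) = ⨆ a ∈ s, g (f a) := by
  rw [hf, ← sSup_image, hg, iSup_image]

lemma Triad.rl_mem_Q1 (τ : Triad L T R) (r : R) (l : L) : τ.rl r l ∈ τ.Q1 := by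
  refine ⟨?_, ?_, ?_, ?_, ?_⟩
  · exact map_map_sSup (f := fun l => τ.pair l r) (g := fun t => τ.smulL t l)
      (fun s => τ.pair_sSup_left s r) (fun s => τ.smulL_sSup_left s l)
  · intro t l'
    simp only [Triad.rl, τ.smulL_pair, τ.smulL_assoc]
  · exact map_map_sSup (τ.pair_sSup_right l) (τ.smulR_sSup_right r)
  · intro r' t
    simp only [Triad.rl, ← τ.pair_smulR, τ.smulR_assoc]
  · intro l' r'
    simp only [Triad.rl, τ.smulL_pair, τ.pair_smulR]

lemma Triad.id_mem_Q1 (τ : Triad L T R) : ((id, id) : (L → L) × (R → R)) ∈ τ.Q1 :=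
  ⟨fun _ => sSup_eq_iSup, fun _ _ => rfl, fun _ => sSup_eq_iSup, fun _ _ => rfl, fun _ _ => rfl⟩

/-- The triad is strong iff the greatest element of `Q₁` is
`⟨⊤_R,⊤_L⟩ = (l ↦ (l·⊤_R)·⊤_L, r ↦ ⊤_R·(⊤_L·r))`. -/
theorem stmt5 (τ : Triad L T R) :
    τ.Strong ↔ IsGreatest τ.Q1 (τ.rl ⊤ ⊤) := by
  refine ⟨fun ⟨hL, hR⟩ => ⟨τ.rl_mem_Q1 ⊤ ⊤, ?_⟩, fun h => h.2 τ.id_mem_Q1⟩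
  rintro ⟨α, β⟩ ⟨-, -, -, -, hαβ⟩
  refine ⟨fun l => (hL (α l)).trans ?_, fun r => (hR (β r)).trans ?_⟩
  · rw [hαβ l ⊤]
    exact monotone_of_map_sSup (f := fun t => τ.smulL t ⊤) (fun s => τ.smulL_sSup_left s ⊤)
      (monotone_of_map_sSup (τ.pair_sSup_right l) le_top)
  · rw [← hαβ ⊤ r]
    exact monotone_of_map_sSup (τ.smulR_sSup_right ⊤)
      (monotone_of_map_sSup (f := fun l => τ.pair l r) (fun s => τ.pair_sSup_left s r) le_top)
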